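/- Let C ∈ ℝ^{m×n}, b ∈ ℝ^m, λ > 0, and f(x) = ½‖x‖₂² + λ‖x‖₁, and let x⋆ be the unique solution of: minimize ½‖x‖₂² + λ‖x‖₁ subject to x ∈ argmin_z ‖b − Cz‖₂. Consider the RSEGS algorithm: initialize y^{(0)} ∈ ℝ^n, z^{(0)} ∈ ran(Cᵀ), x^{(0)} = S_λ(z^{(0)}); at step k pick, independently of all previous choices, a column index j_k ∈ {1,…,n} with probability ‖C_{:,j_k}‖₂²/‖C‖_F² and a row index i_k ∈ {1,…,m} with probability ‖C_{i_k,:}‖₂²/‖C‖_F², and set y^{(k)} = y^{(k−1)} − ((C_{:,j_k})ᵀ(Cy^{(k−1)} − b)/‖C_{:,j_k}‖₂²) e_{j_k}, z^{(k)} = z^{(k−1)} − ((C_{i_k,:}(x^{(k−1)} − y^{(k)}))/‖C_{i_k,:}‖₂²)(C_{i_k,:})ᵀ, x^{(k)} = S_λ(z^{(k)}). Then the RSEGS iterates converge linearly in expectation to x⋆: there exist constants c ≥ 0 and ρ ∈ (0,1) such that E[‖x^{(k)} − x⋆‖₂²] ≤ c·ρ^k for all k ≥ 0. -/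

import Mathlib

open Finset Matrix

noncomputable section

/-- Euclidean inner product on `ℝ^k`. -/
def dotp {k : ℕ} (x y : Fin k → ℝ) : ℝ := ∑ i, x i * y i

/-- Squared Euclidean norm on `ℝ^k`. -/
def sqnorm {k : ℕ} (x : Fin k → ℝ) : ℝ := ∑ i, (x i) ^ 2

/-- Euclidean norm on `ℝ^k`. -/
def nrm {k : ℕ} (x : Fin k → ℝ) : ℝ := Real.sqrt (sqnorm x)

/-- Squared Frobenius norm of a matrix. -/
def frobSq {m l : ℕ} (A : Matrix (Fin m) (Fin l) ℝ) : ℝ := ∑ i, ∑ j, (A i j) ^ 2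

/-- The soft shrinkage function, `(S_λ(x))_i = max{|x_i| − λ, 0}·sgn(x_i)`. -/
def Sshrink {k : ℕ} (lam : ℝ) (x : Fin k → ℝ) : Fin k → ℝ :=
  fun i => max (|x i| - lam) 0 * Real.sign (x i)

/-- One step of the RSEGS algorithm: given the choice `c = (j, i)` of a column
and a row of `C` and the current state `s = (y, z)`, perform one RGS step for
`min ‖b − Cy‖₂` followed by one RSK step for `C x = C y` (with `x = S_λ(z)`). -/
def rsegsStep {m n : ℕ} (C : Matrix (Fin m) (Fin n) ℝ) (b : Fin m → ℝ) (lam : ℝ)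
    (c : Fin n × Fin m) (s : (Fin n → ℝ) × (Fin n → ℝ)) : (Fin n → ℝ) × (Fin n → ℝ) :=
  let y' := Function.update s.1 c.1
      (s.1 c.1 - dotp (Cᵀ c.1) (C.mulVec s.1 - b) / sqnorm (Cᵀ c.1))
  (y', s.2 - (dotp (C c.2) (Sshrink lam s.2 - y') / sqnorm (C c.2)) • C c.2)

/-- The RSEGS iterate obtained from initial state `(y0, z0)` by applying one step
for each entry of the list of index choices. -/
def rsegsIter {m n : ℕ} (C : Matrix (Fin m) (Fin n) ℝ) (b : Fin m → ℝ) (lam : ℝ)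
    (y0 z0 : Fin n → ℝ) : List (Fin n × Fin m) → (Fin n → ℝ) × (Fin n → ℝ)
  | [] => (y0, z0)
  | c :: cs => rsegsStep C b lam c (rsegsIter C b lam y0 z0 cs)

lemma sqnorm_eq_dotProduct {k : ℕ} (x : Fin k → ℝ) : sqnorm x = x ⬝ᵥ x := by
  simp [sqnorm, dotProduct, pow_two]

lemma sqnorm_nonneg {k : ℕ} (x : Fin k → ℝ) : 0 ≤ sqnorm x :=
  sum_nonneg fun _ _ => sq_nonneg _

lemma sqnorm_eq_zero {k : ℕ} {x : Fin k → ℝ} : sqnorm x = 0 ↔ x = 0 := by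
  rw [sqnorm_eq_dotProduct, dotProduct_self_eq_zero]

lemma frobSq_eq_sum_sqnorm {m n : ℕ} (A : Matrix (Fin m) (Fin n) ℝ) :
    frobSq A = ∑ i, sqnorm (A i) := rfl

lemma frobSq_nonneg {m n : ℕ} (A : Matrix (Fin m) (Fin n) ℝ) : 0 ≤ frobSq A :=
  sum_nonneg fun i _ => sqnorm_nonneg (A i)

lemma frobSq_transpose {m n : ℕ} (A : Matrix (Fin m) (Fin n) ℝ) : frobSq Aᵀ = frobSq A := by
  unfold frobSq
  rw [sum_comm]
  rfl

lemma sqnorm_mulVec_le {m n : ℕ} (A : Matrix (Fin m) (Fin n) ℝ) (x : Fin n → ℝ) :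
    sqnorm (A *ᵥ x) ≤ frobSq A * sqnorm x := by
  unfold sqnorm frobSq
  rw [sum_mul]
  exact sum_le_sum fun i _ => sum_mul_sq_le_sq_mul_sq univ (A i) x

lemma sqnorm_add_le {k : ℕ} (x y : Fin k → ℝ) : sqnorm (x + y) ≤ 2 * sqnorm x + 2 * sqnorm y := by
  unfold sqnorm
  rw [mul_sum, mul_sum, ← sum_add_distrib]
  refine sum_le_sum fun i _ => ?_
  simp only [Pi.add_apply]
  nlinarith [sq_nonneg (x i - y i)]

lemma sqnorm_sub_smul {k : ℕ} (x y : Fin k → ℝ) (t : ℝ) :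
    sqnorm (x - t • y) = sqnorm x - 2 * t * (y ⬝ᵥ x) + t ^ 2 * sqnorm y := by
  simp only [sqnorm_eq_dotProduct, sub_dotProduct, dotProduct_sub, smul_dotProduct,
    dotProduct_smul, smul_eq_mul, dotProduct_comm x y]
  ring

lemma dotProduct_transpose_mulVec {m n : ℕ} (A : Matrix (Fin m) (Fin n) ℝ)
    (x : Fin m → ℝ) (y : Fin n → ℝ) : (Aᵀ *ᵥ x) ⬝ᵥ y = x ⬝ᵥ (A *ᵥ y) := by
  rw [mulVec_transpose, ← dotProduct_mulVec]

/-- On the range of `A`, the transpose `Aᵀ` is bounded below. -/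
lemma exists_sqnorm_mulVec_le {m n : ℕ} (A : Matrix (Fin m) (Fin n) ℝ) :
    ∃ L : ℝ, 0 < L ∧ ∀ p, sqnorm (A *ᵥ p) ≤ L * sqnorm (Aᵀ *ᵥ (A *ᵥ p)) := by
  let R := LinearMap.range (toLin' A)
  let g : R →ₗ[ℝ] (Fin n → ℝ) := (toLin' Aᵀ).domRestrict R
  have hg : LinearMap.ker g = ⊥ := by
    rw [LinearMap.ker_eq_bot']
    rintro ⟨_, p, rfl⟩ h
    have h1 : Aᵀ *ᵥ (A *ᵥ p) = 0 := by simpa [g] using h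
    have h2 : (A *ᵥ p) ⬝ᵥ (A *ᵥ p) = 0 := by
      rw [← dotProduct_transpose_mulVec, h1, zero_dotProduct]
    ext1
    simpa using dotProduct_self_eq_zero.1 h2
  obtain ⟨h, hh⟩ := g.exists_leftInverse_of_injective hg
  let G := LinearMap.toMatrix' (R.subtype ∘ₗ h)
  refine ⟨frobSq G + 1, by linarith [frobSq_nonneg G], fun p => ?_⟩
  have key : G *ᵥ (Aᵀ *ᵥ (A *ᵥ p)) = A *ᵥ p := by
    have h1 := LinearMap.congr_fun hh ⟨toLin' A p, p, rfl⟩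
    rw [LinearMap.toMatrix'_mulVec]
    exact congrArg Subtype.val h1
  calc sqnorm (A *ᵥ p) = sqnorm (G *ᵥ (Aᵀ *ᵥ (A *ᵥ p))) := by rw [key]
    _ ≤ frobSq G * sqnorm (Aᵀ *ᵥ (A *ᵥ p)) := sqnorm_mulVec_le _ _
    _ ≤ _ := by gcongr <;> linarith [sqnorm_nonneg (Aᵀ *ᵥ (A *ᵥ p))]

/-- The normal equation satisfied by a least squares solution. -/
lemma transpose_mulVec_residual_eq_zero {m n : ℕ} (C : Matrix (Fin m) (Fin n) ℝ) (b : Fin m → ℝ)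
    (x : Fin n → ℝ) (hx : ∀ u, nrm (b - C *ᵥ x) ≤ nrm (b - C *ᵥ u)) :
    Cᵀ *ᵥ (b - C *ᵥ x) = 0 := by
  set r := b - C *ᵥ x with hr
  set g := Cᵀ *ᵥ r with hg
  have key : ∀ t : ℝ, 2 * t * sqnorm g ≤ t ^ 2 * sqnorm (C *ᵥ g) := fun t => by
    have h1 := (Real.sqrt_le_sqrt_iff (sqnorm_nonneg _)).1 (hx (x + t • g))
    have h2 : b - C *ᵥ (x + t • g) = r - t • (C *ᵥ g) := by
      rw [mulVec_add, mulVec_smul, hr]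
      abel
    rw [h2, sqnorm_sub_smul, dotProduct_comm, ← dotProduct_transpose_mulVec, ← hg,
      ← sqnorm_eq_dotProduct] at h1
    linarith
  have hQ := sqnorm_nonneg (C *ᵥ g)
  rw [← sqnorm_eq_zero]
  by_contra hne
  have hG : 0 < sqnorm g := lt_of_le_of_ne (sqnorm_nonneg _) (Ne.symm hne)
  have h3 := key (1 / (sqnorm (C *ᵥ g) + 1) * sqnorm g)
  set Q := sqnorm (C *ᵥ g)
  set T := 1 / (Q + 1) with hT
  have hTQ : T * Q ≤ 1 := by
    rw [hT, div_mul_eq_mul_div, div_le_one] <;> linarith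
  have hTpos : 0 < T := by positivity
  have h4 : 0 < T * sqnorm g ^ 2 := by positivity
  nlinarith

lemma sshrink_cases {k : ℕ} {lam : ℝ} (hlam : 0 < lam) (z : Fin k → ℝ) (i : Fin k) :
    (lam ≤ z i ∧ Sshrink lam z i = z i - lam) ∨ (z i ≤ -lam ∧ Sshrink lam z i = z i + lam) ∨
      ((-lam ≤ z i ∧ z i ≤ lam) ∧ Sshrink lam z i = 0) := by
  unfold Sshrink
  rcases le_total lam (z i) with h | h
  · left
    rw [abs_of_pos (by linarith), max_eq_left (by linarith), Real.sign_of_pos (by linarith)]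
    exact ⟨h, by ring⟩
  right
  rcases le_total (z i) (-lam) with h' | h'
  · left
    rw [abs_of_neg (by linarith), max_eq_left (by linarith), Real.sign_of_neg (by linarith)]
    exact ⟨h', by ring⟩
  · right
    rw [max_eq_right (by linarith [abs_le.2 ⟨h', h⟩])]
    exact ⟨⟨h', h⟩, by ring⟩

lemma sshrink_eq_sub_clip {k : ℕ} {lam : ℝ} (hlam : 0 < lam) (z : Fin k → ℝ) (i : Fin k) :
    Sshrink lam z i = z i - max (-lam) (min (z i) lam) := by
  rcases sshrink_cases hlam z i with ⟨h, e⟩ | ⟨h, e⟩ | ⟨⟨h, h'⟩, e⟩ <;> rw [e]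
  · rw [min_eq_right h, max_eq_right (by linarith)]
  · rw [min_eq_left (by linarith), max_eq_left h]; ring
  · rw [min_eq_left h', max_eq_right h]; ring

lemma continuous_sshrink {k : ℕ} {lam : ℝ} (hlam : 0 < lam) :
    Continuous (Sshrink lam : (Fin k → ℝ) → Fin k → ℝ) := by
  refine continuous_pi fun i => ?_
  simp only [sshrink_eq_sub_clip hlam]
  fun_prop

lemma continuous_sqnorm {k : ℕ} : Continuous (sqnorm : (Fin k → ℝ) → ℝ) := by
  unfold sqnorm
  fun_prop

/-- The Bregman distance between `Sshrink lam z` and `x` with respect to the subgradient `z`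
of `½‖·‖₂² + lam‖·‖₁`. -/
def bregman {k : ℕ} (lam : ℝ) (x z : Fin k → ℝ) : ℝ :=
  ∑ i, (1 / 2 * Sshrink lam z i ^ 2 - z i * x i + 1 / 2 * x i ^ 2 + lam * |x i|)

lemma half_sqnorm_le_bregman {k : ℕ} {lam : ℝ} (hlam : 0 < lam) (x z : Fin k → ℝ) :
    1 / 2 * sqnorm (Sshrink lam z - x) ≤ bregman lam x z := by
  unfold sqnorm bregman
  rw [mul_sum]
  refine sum_le_sum fun i _ => ?_
  simp only [Pi.sub_apply]
  rcases sshrink_cases hlam z i with ⟨h, e⟩ | ⟨h, e⟩ | ⟨⟨h, h'⟩, e⟩ <;> rw [e] <;>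
    cases abs_cases (x i) <;> nlinarith

lemma bregman_nonneg {k : ℕ} {lam : ℝ} (hlam : 0 < lam) (x z : Fin k → ℝ) :
    0 ≤ bregman lam x z :=
  le_trans (by linarith [sqnorm_nonneg (Sshrink lam z - x)]) (half_sqnorm_le_bregman hlam x z)

lemma exists_bregman_le {k : ℕ} {lam : ℝ} (hlam : 0 < lam) (x : Fin k → ℝ) :
    ∃ K : ℝ, 0 < K ∧ ∀ z, bregman lam x z ≤ K * sqnorm (Sshrink lam z - x) := by
  let K := 1 / 2 + ∑ i, 2 * lam / |x i|
  have hK : ∀ i, 1 / 2 + 2 * lam / |x i| ≤ K := fun i => by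
    have := single_le_sum (f := fun i => 2 * lam / |x i|) (fun i _ => by positivity) (mem_univ i)
    simp only [K]
    linarith
  refine ⟨K, by positivity, fun z => ?_⟩
  unfold bregman sqnorm
  rw [mul_sum]
  refine sum_le_sum fun i _ => le_trans ?_ (mul_le_mul_of_nonneg_right (hK i) (sq_nonneg _))
  simp only [Pi.sub_apply]
  set s := Sshrink lam z i with hs
  have main : lam * |x i| - (z i - s) * x i ≤ 2 * lam / |x i| * (s - x i) ^ 2 := by
    rcases eq_or_ne (x i) 0 with h0 | h0
    · simp [h0]
    have hpos := abs_pos.2 h0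
    rw [div_mul_eq_mul_div, le_div_iff₀ hpos]
    rcases sshrink_cases hlam z i with ⟨h, e⟩ | ⟨h, e⟩ | ⟨⟨h, h'⟩, e⟩ <;> rw [← hs] at e <;>
      rcases abs_cases (x i) with ⟨ha, hx⟩ | ⟨ha, hx⟩ <;> rw [ha]
    · have : z i - s = lam := by linarith
      rw [this]; nlinarith [mul_nonneg hlam.le (sq_nonneg (s - x i))]
    · have : z i - s = lam := by linarith
      have hs0 : 0 ≤ s := by linarith
      rw [this]
      nlinarith [mul_nonneg hlam.le (mul_nonneg hs0 (neg_nonneg.2 hx.le)),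
        mul_nonneg hlam.le (sq_nonneg s)]
    · have : z i - s = -lam := by linarith
      have hs0 : 0 ≤ -s := by linarith
      rw [this]
      nlinarith [mul_nonneg hlam.le (mul_nonneg hs0 hx), mul_nonneg hlam.le (sq_nonneg s)]
    · have : z i - s = -lam := by linarith
      rw [this]; nlinarith [mul_nonneg hlam.le (sq_nonneg (s - x i))]
    · rw [e]
      nlinarith [mul_nonneg (by linarith : 0 ≤ z i + lam) (sq_nonneg (x i))]
    · rw [e]
      nlinarith [mul_nonneg (by linarith : 0 ≤ lam - z i) (sq_nonneg (x i))]
  linarith [main]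

lemma bregman_sub_smul_le {k : ℕ} {lam : ℝ} (hlam : 0 < lam) (x z a : Fin k → ℝ) (t : ℝ) :
    bregman lam x (z - t • a) ≤
      bregman lam x z - t * (a ⬝ᵥ (Sshrink lam z - x)) + 1 / 2 * t ^ 2 * sqnorm a := by
  unfold bregman sqnorm dotProduct
  rw [mul_sum, mul_sum, ← sum_sub_distrib, ← sum_add_distrib]
  refine sum_le_sum fun i _ => ?_
  set w := z - t • a with hw
  have hwi : w i = z i - t * a i := by simp [hw]
  simp only [Pi.sub_apply]
  have key : Sshrink lam w i ^ 2 ≤ (w i - (z i - Sshrink lam z i)) ^ 2 := by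
    have hc : -lam ≤ z i - Sshrink lam z i ∧ z i - Sshrink lam z i ≤ lam := by
      rcases sshrink_cases hlam z i with ⟨h, e⟩ | ⟨h, e⟩ | ⟨⟨h, h'⟩, e⟩ <;> rw [e] <;>
        constructor <;> linarith
    rcases sshrink_cases hlam w i with ⟨h, e⟩ | ⟨h, e⟩ | ⟨⟨h, h'⟩, e⟩ <;> rw [e]
    · exact pow_le_pow_left₀ (by linarith) (by linarith) 2
    · rw [← neg_sq (w i + lam), ← neg_sq (w i - _)]
      exact pow_le_pow_left₀ (by linarith) (by linarith) 2
    · rw [zero_pow two_ne_zero]; exact sq_nonneg _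
  rw [hwi] at key ⊢
  nlinarith [key]

/-- The closed polyhedra on which the soft shrinkage is affine, indexed by sign patterns. -/
def shrinkFace {k : ℕ} (lam : ℝ) (σ : Fin k → SignType) : Set (Fin k → ℝ) :=
  {z | ∀ i, (σ i = 1 → lam ≤ z i) ∧ (σ i = -1 → z i ≤ -lam) ∧
    (σ i = 0 → -lam ≤ z i ∧ z i ≤ lam)}

lemma exists_mem_shrinkFace {k : ℕ} {lam : ℝ} (hlam : 0 < lam) (z : Fin k → ℝ) :
    ∃ σ, z ∈ shrinkFace lam σ := by
  have : ∀ i, ∃ τ : SignType, (τ = 1 → lam ≤ z i) ∧ (τ = -1 → z i ≤ -lam) ∧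
      (τ = 0 → -lam ≤ z i ∧ z i ≤ lam) := fun i => by
    rcases sshrink_cases hlam z i with ⟨h, -⟩ | ⟨h, -⟩ | ⟨h, -⟩
    · exact ⟨1, by simpa using h⟩
    · exact ⟨-1, by simpa using h⟩
    · exact ⟨0, by simpa using h⟩
  choose σ hσ using this
  exact ⟨σ, hσ⟩

lemma isClosed_shrinkFace {k : ℕ} (lam : ℝ) (σ : Fin k → SignType) :
    IsClosed (shrinkFace lam σ) := by
  simp only [shrinkFace, Set.ofPred_forall]
  refine isClosed_iInter fun i => ?_
  rcases SignType.trichotomy (σ i) with h | h | h <;> simp only [h]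
  · simpa using isClosed_le (continuous_apply i) continuous_const
  · simp
    exact isClosed_Icc.preimage (continuous_apply i)
  · simpa using isClosed_le continuous_const (continuous_apply i)

/-- On a fixed face the soft shrinkage is affine with diagonal zero-one linear part. -/
lemma sshrink_sub_of_mem_shrinkFace {k : ℕ} {lam : ℝ} (hlam : 0 < lam) {σ : Fin k → SignType}
    {z w : Fin k → ℝ} (hz : z ∈ shrinkFace lam σ) (hw : w ∈ shrinkFace lam σ) :
    Sshrink lam z - Sshrink lam w =
      diagonal (fun i => if σ i = 0 then (0 : ℝ) else 1) *ᵥ (z - w) := by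
  ext i
  rw [mulVec_diagonal]
  simp only [Pi.sub_apply]
  have hzi := hz i
  have hwi := hw i
  rcases SignType.trichotomy (σ i) with h | h | h <;> simp [h] at hzi hwi ⊢ <;>
  rcases sshrink_cases hlam z i with ⟨h1, e1⟩ | ⟨h1, e1⟩ | ⟨⟨h1, h1'⟩, e1⟩ <;>
  rcases sshrink_cases hlam w i with ⟨h2, e2⟩ | ⟨h2, e2⟩ | ⟨⟨h2, h2'⟩, e2⟩ <;>
  rw [e1, e2] <;> linarith

lemma sqnorm_sub_sshrink_le {k : ℕ} {lam : ℝ} (hlam : 0 < lam) (z : Fin k → ℝ) :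
    sqnorm (z - Sshrink lam z) ≤ k * lam ^ 2 := by
  have : ∀ i ∈ univ, (z - Sshrink lam z) i ^ 2 ≤ lam ^ 2 := fun i _ => by
    rw [Pi.sub_apply, sq_le_sq, abs_of_pos hlam, abs_le]
    rcases sshrink_cases hlam z i with ⟨h, e⟩ | ⟨h, e⟩ | ⟨⟨h, h'⟩, e⟩ <;> rw [e] <;>
      constructor <;> linarith
  simpa [sqnorm] using sum_le_sum this

/-- Growth of the residual of the shrinkage over the range of `Cᵀ`. -/
lemma exists_growth {m n : ℕ} (C : Matrix (Fin m) (Fin n) ℝ) {lam : ℝ} (hlam : 0 < lam)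
    (x : Fin n → ℝ) :
    ∃ a B : ℝ, 0 < a ∧ 0 ≤ B ∧ ∀ p,
      sqnorm (Cᵀ *ᵥ p) ≤ a * sqnorm (C *ᵥ (Sshrink lam (Cᵀ *ᵥ p) - x)) + B ∧
      sqnorm (Sshrink lam (Cᵀ *ᵥ p) - x) ≤
        a * sqnorm (C *ᵥ (Sshrink lam (Cᵀ *ᵥ p) - x)) + B := by
  obtain ⟨L, hL, hLC⟩ := exists_sqnorm_mulVec_le Cᵀ
  let B₀ := 2 * (n * lam ^ 2) + 2 * sqnorm x
  have hB₀ : 0 ≤ B₀ := by have := sqnorm_nonneg x; positivity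
  have hF := frobSq_nonneg C
  refine ⟨4 * L, 4 * L * (frobSq C * B₀) + 2 * B₀, by positivity, by positivity, fun p => ?_⟩
  have h0 := hLC p
  rw [transpose_transpose] at h0
  set z := Cᵀ *ᵥ p
  set e := Sshrink lam z - x with he
  set d := z - Sshrink lam z + x with hd
  have hde : z = e + d := by rw [he, hd]; abel
  have hed : e = z + (-1 : ℝ) • d := by rw [hde, neg_one_smul]; abel
  have hdB : sqnorm d ≤ B₀ := (sqnorm_add_le _ _).trans (by
    have := sqnorm_sub_sshrink_le hlam z
    simp only [B₀]; linarith)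
  have h1 : sqnorm (C *ᵥ z) ≤ 2 * sqnorm (C *ᵥ e) + 2 * (frobSq C * B₀) := by
    conv_lhs => rw [hde, mulVec_add]
    refine (sqnorm_add_le _ _).trans ?_
    have := (sqnorm_mulVec_le C d).trans (mul_le_mul_of_nonneg_left hdB hF)
    linarith
  have h2 : sqnorm e ≤ 2 * sqnorm z + 2 * sqnorm d := by
    conv_lhs => rw [hed]
    refine (sqnorm_add_le _ _).trans_eq ?_
    congr 2
    simp [sqnorm]
  have h3 := h0.trans (mul_le_mul_of_nonneg_left h1 hL.le)
  have h4 := mul_nonneg hL.le (sqnorm_nonneg (C *ᵥ e))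
  have h5 : 0 ≤ L * (frobSq C * B₀) := by positivity
  constructor <;> linarith

/-- The error bound on a single face. -/
lemma exists_error_bound_of_face {m n : ℕ} (C : Matrix (Fin m) (Fin n) ℝ) {lam : ℝ}
    (hlam : 0 < lam) (x : Fin n → ℝ)
    (huniq : ∀ p, C *ᵥ (Sshrink lam (Cᵀ *ᵥ p) - x) = 0 → Sshrink lam (Cᵀ *ᵥ p) = x)
    (σ : Fin n → SignType) :
    ∃ L : ℝ, 0 < L ∧ ∀ p, Cᵀ *ᵥ p ∈ shrinkFace lam σ →
      sqnorm (Sshrink lam (Cᵀ *ᵥ p) - x) ≤ L * sqnorm (C *ᵥ (Sshrink lam (Cᵀ *ᵥ p) - x)) := by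
  by_cases hex : ∃ p₀, Cᵀ *ᵥ p₀ ∈ shrinkFace lam σ ∧ Sshrink lam (Cᵀ *ᵥ p₀) = x
  · obtain ⟨p₀, hp₀, rfl⟩ := hex
    set D : Matrix (Fin n) (Fin n) ℝ := diagonal (fun i => if σ i = 0 then (0 : ℝ) else 1)
    obtain ⟨L, hL, hLA⟩ := exists_sqnorm_mulVec_le (D * Cᵀ)
    refine ⟨L, hL, fun p hp => ?_⟩
    have hu : Sshrink lam (Cᵀ *ᵥ p) - Sshrink lam (Cᵀ *ᵥ p₀) = (D * Cᵀ) *ᵥ (p - p₀) := by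
      rw [sshrink_sub_of_mem_shrinkFace hlam hp hp₀, ← mulVec_sub, mulVec_mulVec]
    have hDD : D * D = D := by
      simp [D, diagonal_mul_diagonal]
    have hC : (D * Cᵀ)ᵀ *ᵥ ((D * Cᵀ) *ᵥ (p - p₀)) = C *ᵥ ((D * Cᵀ) *ᵥ (p - p₀)) := by
      rw [transpose_mul, transpose_transpose, diagonal_transpose, mulVec_mulVec, mulVec_mulVec,
        Matrix.mul_assoc, ← Matrix.mul_assoc D, hDD]
    rw [hu, ← hC]
    exact hLA _
  · push Not at hex
    obtain ⟨a, B, ha, hB, hgrow⟩ := exists_growth C hlam x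
    let φ : (Fin n → ℝ) → ℝ := fun z => sqnorm (C *ᵥ (Sshrink lam z - x))
    have hφ : Continuous φ := continuous_sqnorm.comp
      (((toLin' C).continuous_of_finiteDimensional).comp
        ((continuous_sshrink hlam).sub continuous_const))
    have hpos : ∀ p, Cᵀ *ᵥ p ∈ shrinkFace lam σ → 0 < φ (Cᵀ *ᵥ p) := fun p hp =>
      lt_of_le_of_ne (sqnorm_nonneg _) fun h =>
        hex p hp (huniq p (sqnorm_eq_zero.1 h.symm))
    let S : Set (Fin n → ℝ) := (LinearMap.range (toLin' Cᵀ) : Set (Fin n → ℝ)) ∩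
      shrinkFace lam σ ∩ {z | sqnorm z ≤ a + B}
    have hS : IsCompact S := by
      refine IsCompact.of_isClosed_subset
        (isCompact_Icc (a := fun _ : Fin n => -(a + B + 1)) (b := fun _ => a + B + 1)) ?_ ?_
      · exact ((Submodule.closed_of_finiteDimensional _).inter (isClosed_shrinkFace lam σ)).inter
          (isClosed_le continuous_sqnorm continuous_const)
      · rintro z ⟨-, hz⟩
        have hz' : ∀ i, z i ^ 2 ≤ a + B := fun i =>
          (single_le_sum (f := fun i => z i ^ 2) (fun i _ => sq_nonneg _) (mem_univ i)).trans hz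
        exact ⟨fun i => by simp only; nlinarith [hz' i], fun i => by simp only; nlinarith [hz' i]⟩
    obtain ⟨ε, hε, hε1, hεS⟩ : ∃ ε : ℝ, 0 < ε ∧ ε ≤ 1 ∧ ∀ z ∈ S, ε ≤ φ z := by
      rcases S.eq_empty_or_nonempty with h | h
      · exact ⟨1, one_pos, le_rfl, by simp [h]⟩
      · obtain ⟨z₀, hz₀, hmin⟩ := hS.exists_isMinOn h hφ.continuousOn
        obtain ⟨⟨⟨p, rfl⟩, hp⟩, -⟩ := id hz₀
        exact ⟨min 1 (φ _), lt_min one_pos (hpos p hp), min_le_left _ _,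
          fun z hz => (min_le_right _ _).trans (hmin hz)⟩
    refine ⟨a + B / ε, by positivity, fun p hp => ?_⟩
    have hle : ε ≤ φ (Cᵀ *ᵥ p) := by
      by_contra! hlt
      refine hlt.not_ge (hεS _ ⟨⟨⟨p, rfl⟩, hp⟩, (hgrow p).1.trans ?_⟩)
      have := mul_le_mul_of_nonneg_left (hlt.le.trans hε1) ha.le
      linarith
    refine (hgrow p).2.trans ?_
    rw [add_mul]
    gcongr
    rw [div_mul_eq_mul_div, le_div_iff₀ hε]
    exact mul_le_mul_of_nonneg_left hle hB

lemma exists_error_bound {m n : ℕ} (C : Matrix (Fin m) (Fin n) ℝ) {lam : ℝ}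
    (hlam : 0 < lam) (x : Fin n → ℝ)
    (huniq : ∀ p, C *ᵥ (Sshrink lam (Cᵀ *ᵥ p) - x) = 0 → Sshrink lam (Cᵀ *ᵥ p) = x) :
    ∃ L : ℝ, 0 < L ∧ ∀ p,
      bregman lam x (Cᵀ *ᵥ p) ≤ L * sqnorm (C *ᵥ (Sshrink lam (Cᵀ *ᵥ p) - x)) := by
  choose L hL hbound using exists_error_bound_of_face C hlam x huniq
  obtain ⟨K, hK, hKb⟩ := exists_bregman_le hlam x
  refine ⟨K * ∑ σ, L σ, mul_pos hK (sum_pos (fun σ _ => hL σ) univ_nonempty), fun p => ?_⟩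
  obtain ⟨σ, hσ⟩ := exists_mem_shrinkFace hlam (Cᵀ *ᵥ p)
  refine (hKb _).trans ?_
  rw [mul_assoc]
  refine mul_le_mul_of_nonneg_left ((hbound σ p hσ).trans ?_) hK.le
  exact mul_le_mul_of_nonneg_right
    (single_le_sum (f := L) (fun σ _ => (hL σ).le) (mem_univ σ)) (sqnorm_nonneg _)

/-- A feasible point with a subgradient in the range of `Cᵀ` is the minimizer. -/
lemma sshrink_eq_of_mulVec_sub_eq_zero {m n : ℕ} (C : Matrix (Fin m) (Fin n) ℝ) {lam : ℝ}
    (hlam : 0 < lam) (x : Fin n → ℝ)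
    (hmin : ∀ u, C *ᵥ u = C *ᵥ x →
      1 / 2 * sqnorm x + lam * ∑ t, |x t| ≤ 1 / 2 * sqnorm u + lam * ∑ t, |u t|)
    (p : Fin m → ℝ) (h : C *ᵥ (Sshrink lam (Cᵀ *ᵥ p) - x) = 0) :
    Sshrink lam (Cᵀ *ᵥ p) = x := by
  set z := Cᵀ *ᵥ p with hz
  set s := Sshrink lam z with hs
  have hf := hmin s (sub_eq_zero.1 (by rw [← mulVec_sub, h]))
  have hzs : z ⬝ᵥ (s - x) = 0 := by rw [hz, dotProduct_transpose_mulVec, h, dotProduct_zero]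
  have key : bregman lam x z = (1 / 2 * sqnorm x + lam * ∑ t, |x t|) -
      (1 / 2 * sqnorm s + lam * ∑ t, |s t|) + z ⬝ᵥ (s - x) := by
    unfold bregman sqnorm dotProduct
    simp only [mul_sum, ← sum_add_distrib, ← sum_sub_distrib]
    refine sum_congr rfl fun i _ => ?_
    have habs : lam * |s i| = (z i - s i) * s i := by
      rcases sshrink_cases hlam z i with ⟨h, e⟩ | ⟨h, e⟩ | ⟨⟨h, h'⟩, e⟩ <;>
        rw [← hs] at e <;> rw [e]
      · rw [abs_of_nonneg (by linarith)]; ring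
      · rw [abs_of_nonpos (by linarith)]; ring
      · simp
    rw [habs, ← hs, Pi.sub_apply]
    ring
  have h1 := half_sqnorm_le_bregman hlam x z
  have h2 := sqnorm_nonneg (s - x)
  rw [← hs] at h1
  exact sub_eq_zero.1 (sqnorm_eq_zero.1 (by linarith))

/-- Expected geometric decay of a potential along independently driven iterates. -/
lemma sum_prod_mul_le_pow {α S : Type*} [Fintype α] (w : α → ℝ) (hw : ∀ c, 0 ≤ w c)
    (step : α → S → S) (iter : List α → S) (hiter : ∀ c cs, iter (c :: cs) = step c (iter cs))
    (Inv : S → Prop) (hInv : ∀ cs, Inv (iter cs))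
    (V : S → ℝ) (ρ : ℝ) (hρ : 0 ≤ ρ) (hV : ∀ s, Inv s → ∑ c, w c * V (step c s) ≤ ρ * V s)
    (k : ℕ) :
    ∑ s : Fin k → α, (∏ t, w (s t)) * V (iter (List.ofFn s)) ≤ V (iter []) * ρ ^ k := by
  induction k with
  | zero => simp
  | succ k ih =>
    rw [← (Fin.consEquiv fun _ => α).sum_comp, Fintype.sum_prod_type, sum_comm]
    calc _ = ∑ s : Fin k → α, (∏ t, w (s t)) *
          ∑ c, w c * V (step c (iter (List.ofFn s))) := by
          refine sum_congr rfl fun s _ => ?_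
          rw [mul_sum]
          refine sum_congr rfl fun c _ => ?_
          rw [Fin.prod_univ_succ, List.ofFn_succ, hiter]
          simp only [Fin.consEquiv, Equiv.coe_fn_mk, Fin.cons_zero, Fin.cons_succ]
          ring
      _ ≤ ∑ s : Fin k → α, (∏ t, w (s t)) * (ρ * V (iter (List.ofFn s))) := by
          gcongr with s _
          · exact prod_nonneg fun t _ => hw _
          · exact hV _ (hInv _)
      _ = ρ * ∑ s : Fin k → α, (∏ t, w (s t)) * V (iter (List.ofFn s)) := by
          rw [mul_sum]
          exact sum_congr rfl fun s _ => by ring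
      _ ≤ ρ * (V (iter []) * ρ ^ k) := mul_le_mul_of_nonneg_left ih hρ
      _ = _ := by ring

lemma sum_sqnorm_div_frobSq {m n : ℕ} (A : Matrix (Fin m) (Fin n) ℝ) (hA : frobSq A ≠ 0) :
    ∑ i, sqnorm (A i) / frobSq A = 1 := by
  rw [← sum_div, ← frobSq_eq_sum_sqnorm, div_self hA]

/-- Expected decrease of the Bregman distance in a randomized sparse Kaczmarz step with
perturbed right-hand side `C *ᵥ y`. -/
lemma sum_bregman_kaczmarz_le {m n : ℕ} (C : Matrix (Fin m) (Fin n) ℝ) (hF : frobSq C ≠ 0)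
    {lam : ℝ} (hlam : 0 < lam) (x y z : Fin n → ℝ) :
    ∑ i, sqnorm (C i) / frobSq C *
        bregman lam x (z - (C i ⬝ᵥ (Sshrink lam z - y) / sqnorm (C i)) • C i) ≤
      bregman lam x z - 1 / (2 * frobSq C) * sqnorm (C *ᵥ (Sshrink lam z - x)) +
        1 / (2 * frobSq C) * sqnorm (C *ᵥ (y - x)) := by
  set s := Sshrink lam z with hs
  have hi : ∀ i, sqnorm (C i) / frobSq C *
        bregman lam x (z - (C i ⬝ᵥ (s - y) / sqnorm (C i)) • C i) ≤
      sqnorm (C i) / frobSq C * bregman lam x z -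
        1 / (2 * frobSq C) * ((C *ᵥ (s - x)) i) ^ 2 +
        1 / (2 * frobSq C) * ((C *ᵥ (y - x)) i) ^ 2 := fun i => by
    change _ ≤ _ - 1 / (2 * frobSq C) * (C i ⬝ᵥ (s - x)) ^ 2 +
      1 / (2 * frobSq C) * (C i ⬝ᵥ (y - x)) ^ 2
    rcases eq_or_ne (sqnorm (C i)) 0 with h | h
    · simp [sqnorm_eq_zero.1 h, sqnorm]
    have hb := mul_le_mul_of_nonneg_left
      (bregman_sub_smul_le hlam x z (C i) (C i ⬝ᵥ (s - y) / sqnorm (C i)))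
      (div_nonneg (sqnorm_nonneg (C i)) (frobSq_nonneg C))
    refine hb.trans_eq ?_
    have hsplit : C i ⬝ᵥ (s - y) = C i ⬝ᵥ (s - x) - C i ⬝ᵥ (y - x) := by
      rw [← dotProduct_sub, sub_sub_sub_cancel_right]
    rw [← hs, hsplit]
    field_simp
    ring
  refine (sum_le_sum fun i _ => hi i).trans_eq ?_
  rw [sum_add_distrib, sum_sub_distrib, ← sum_mul, sum_sqnorm_div_frobSq C hF, one_mul,
    ← mul_sum, ← mul_sum]
  rfl

/-- Expected decrease of the residual in a randomized Gauss–Seidel step. -/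
lemma sum_sqnorm_gaussSeidel {m n : ℕ} (C : Matrix (Fin m) (Fin n) ℝ) (hF : frobSq C ≠ 0)
    (w : Fin m → ℝ) :
    ∑ j, sqnorm (Cᵀ j) / frobSq C * sqnorm (w - (Cᵀ j ⬝ᵥ w / sqnorm (Cᵀ j)) • Cᵀ j) =
      sqnorm w - 1 / frobSq C * sqnorm (Cᵀ *ᵥ w) := by
  have hj : ∀ j, sqnorm (Cᵀ j) / frobSq C *
      sqnorm (w - (Cᵀ j ⬝ᵥ w / sqnorm (Cᵀ j)) • Cᵀ j) =
      sqnorm (Cᵀ j) / frobSq C * sqnorm w - 1 / frobSq C * ((Cᵀ *ᵥ w) j) ^ 2 := fun j => by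
    change _ = _ - 1 / frobSq C * (Cᵀ j ⬝ᵥ w) ^ 2
    rcases eq_or_ne (sqnorm (Cᵀ j)) 0 with h | h
    · simp [sqnorm_eq_zero.1 h, sqnorm]
    rw [sqnorm_sub_smul]
    field_simp
    ring
  have hsum := sum_sqnorm_div_frobSq Cᵀ (by rwa [frobSq_transpose])
  rw [frobSq_transpose] at hsum
  rw [sum_congr rfl fun j _ => hj j, sum_sub_distrib, ← sum_mul, hsum, one_mul, ← mul_sum]
  rfl

/-- The residual after the coordinate update of a Gauss–Seidel step. -/
lemma mulVec_update_sub {m n : ℕ} (C : Matrix (Fin m) (Fin n) ℝ) (x y : Fin n → ℝ)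
    (j : Fin n) (d : ℝ) :
    C *ᵥ (Function.update y j (y j - d) - x) = C *ᵥ (y - x) - d • Cᵀ j := by
  have : Function.update y j (y j - d) - x = y - x - d • Pi.single j 1 := by
    ext i
    rcases eq_or_ne i j with rfl | h
    · simp; ring
    · simp [h]
  rw [this, mulVec_sub, mulVec_smul, mulVec_single_one]
  rfl

lemma dotp_residual_eq {m n : ℕ} {C : Matrix (Fin m) (Fin n) ℝ} {b : Fin m → ℝ}
    {x : Fin n → ℝ} (hx : Cᵀ *ᵥ (b - C *ᵥ x) = 0) (y : Fin n → ℝ) (j : Fin n) :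
    dotp (Cᵀ j) (C *ᵥ y - b) = Cᵀ j ⬝ᵥ (C *ᵥ (y - x)) := by
  have h1 : C *ᵥ (y - x) = C *ᵥ y - b + (b - C *ᵥ x) := by rw [mulVec_sub]; abel
  have h2 : Cᵀ j ⬝ᵥ (b - C *ᵥ x) = 0 := congrFun hx j
  rw [h1, dotProduct_add, h2, add_zero]
  rfl

lemma rsegsIter_snd_mem_range {m n : ℕ} (C : Matrix (Fin m) (Fin n) ℝ) (b : Fin m → ℝ)
    (lam : ℝ) (y0 z0 : Fin n → ℝ) (hz0 : z0 ∈ Set.range Cᵀ.mulVec) (cs : List (Fin n × Fin m)) :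
    (rsegsIter C b lam y0 z0 cs).2 ∈ Set.range Cᵀ.mulVec := by
  induction cs with
  | nil => exact hz0
  | cons c cs ih =>
    obtain ⟨p, hp⟩ := ih
    have hrow : Cᵀ *ᵥ Pi.single c.2 1 = C c.2 := mulVec_single_one _ _
    have hmem : ∀ t : ℝ, (rsegsIter C b lam y0 z0 cs).2 - t • C c.2 ∈ Set.range Cᵀ.mulVec :=
      fun t => ⟨p - t • Pi.single c.2 1, by rw [mulVec_sub, mulVec_smul, hrow, hp]⟩
    exact hmem _

/-- One step contraction of the potential combining both residuals. -/
lemma exists_potential_contraction {m n : ℕ} (C : Matrix (Fin m) (Fin n) ℝ) (hF : 0 < frobSq C)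
    (b : Fin m → ℝ) {lam : ℝ} (hlam : 0 < lam) (x : Fin n → ℝ)
    (hx : Cᵀ *ᵥ (b - C *ᵥ x) = 0)
    (huniq : ∀ p, C *ᵥ (Sshrink lam (Cᵀ *ᵥ p) - x) = 0 → Sshrink lam (Cᵀ *ᵥ p) = x) :
    ∃ K ρ : ℝ, 0 ≤ K ∧ 0 < ρ ∧ ρ < 1 ∧ ∀ s : (Fin n → ℝ) × (Fin n → ℝ),
      s.2 ∈ Set.range Cᵀ.mulVec →
      ∑ c : Fin n × Fin m, (sqnorm (Cᵀ c.1) / frobSq C * (sqnorm (C c.2) / frobSq C)) *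
          (bregman lam x (rsegsStep C b lam c s).2 +
            K * sqnorm (C *ᵥ ((rsegsStep C b lam c s).1 - x))) ≤
        ρ * (bregman lam x s.2 + K * sqnorm (C *ᵥ (s.1 - x))) := by
  obtain ⟨M, hM, hMC⟩ := exists_sqnorm_mulVec_le C
  obtain ⟨L, hL, hLC⟩ := exists_error_bound C hlam x huniq
  set F := frobSq C with hFdef
  let β := 1 - 1 / (F * M + 1)
  let q := 1 / (2 * F * L + 1)
  have hβ0 : 0 < β := by
    have : 1 / (F * M + 1) < 1 := by
      rw [div_lt_one] <;> linarith [mul_pos hF hM]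
    simp only [β]; linarith
  have hβ1 : 0 < 1 - β := by
    simp only [β, sub_sub_cancel]; positivity
  have hq0 : 0 < q := by positivity
  let K := β / F / (1 - β)
  have hK : 0 ≤ K := by positivity
  refine ⟨K, max ((1 + β) / 2) (1 - q), hK, lt_max_of_lt_left (by linarith),
    max_lt (by linarith) (by linarith), ?_⟩
  rintro ⟨y, _⟩ ⟨p, rfl⟩
  set z := Cᵀ *ᵥ p
  set w := C *ᵥ (y - x) with hw
  let w' := fun j => w - (Cᵀ j ⬝ᵥ w / sqnorm (Cᵀ j)) • Cᵀ j
  have hw' : ∀ j, C *ᵥ (Function.update y j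
      (y j - dotp (Cᵀ j) (C.mulVec y - b) / sqnorm (Cᵀ j)) - x) = w' j := fun j => by
    rw [mulVec_update_sub, dotp_residual_eq hx]
  have hGS : ∑ j, sqnorm (Cᵀ j) / F * sqnorm (w' j) ≤ β * sqnorm w := by
    rw [sum_sqnorm_gaussSeidel C hF.ne' w]
    have h1 : sqnorm w ≤ M * sqnorm (Cᵀ *ᵥ w) := hMC _
    have h2 : 1 / (F * M + 1) * sqnorm w ≤ 1 / F * sqnorm (Cᵀ *ᵥ w) := by
      rw [div_mul_eq_mul_div, div_mul_eq_mul_div, div_le_div_iff₀ (by positivity) hF]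
      nlinarith [mul_le_mul_of_nonneg_left h1 hF.le, sqnorm_nonneg (Cᵀ *ᵥ w)]
    simp only [β]
    linarith
  have hRK : bregman lam x z - 1 / (2 * F) * sqnorm (C *ᵥ (Sshrink lam z - x)) ≤
      (1 - q) * bregman lam x z := by
    have h1 : bregman lam x z ≤ L * sqnorm (C *ᵥ (Sshrink lam z - x)) := hLC p
    have h2 : q * bregman lam x z ≤ 1 / (2 * F) * sqnorm (C *ᵥ (Sshrink lam z - x)) := by
      simp only [q]
      rw [div_mul_eq_mul_div, div_mul_eq_mul_div, div_le_div_iff₀ (by positivity) (by positivity)]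
      nlinarith [mul_le_mul_of_nonneg_left h1 hF.le, sqnorm_nonneg (C *ᵥ (Sshrink lam z - x))]
    linarith
  have hcol : ∑ j, sqnorm (Cᵀ j) / F = 1 := by
    rw [hFdef, ← frobSq_transpose]
    exact sum_sqnorm_div_frobSq _ (by rw [frobSq_transpose]; exact hF.ne')
  have hstep : ∀ j, ∑ i, (sqnorm (Cᵀ j) / F * (sqnorm (C i) / F)) *
      (bregman lam x (rsegsStep C b lam (j, i) (y, z)).2 +
        K * sqnorm (C *ᵥ ((rsegsStep C b lam (j, i) (y, z)).1 - x))) ≤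
      sqnorm (Cᵀ j) / F * ((1 - q) * bregman lam x z) +
        (1 / (2 * F) + K) * (sqnorm (Cᵀ j) / F * sqnorm (w' j)) := fun j => by
    have h1 := sum_bregman_kaczmarz_le C hF.ne' hlam x
      (Function.update y j (y j - dotp (Cᵀ j) (C.mulVec y - b) / sqnorm (Cᵀ j))) z
    rw [hw'] at h1
    have h2 := mul_le_mul_of_nonneg_left (h1.trans (add_le_add_left hRK _))
      (div_nonneg (sqnorm_nonneg (Cᵀ j)) hF.le)
    simp only [rsegsStep, hw']
    calc _ = sqnorm (Cᵀ j) / F * (∑ i, sqnorm (C i) / F * bregman lam x (z -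
          (C i ⬝ᵥ (Sshrink lam z - Function.update y j
            (y j - dotp (Cᵀ j) (C.mulVec y - b) / sqnorm (Cᵀ j))) / sqnorm (C i)) • C i)) +
          (∑ i, sqnorm (C i) / F) * (sqnorm (Cᵀ j) / F * (K * sqnorm (w' j))) := by
          rw [mul_sum, sum_mul, ← sum_add_distrib]
          refine sum_congr rfl fun i _ => ?_
          simp only [dotp, dotProduct]
          ring
      _ ≤ _ := by
          rw [sum_sqnorm_div_frobSq C hF.ne']
          linarith
  rw [Fintype.sum_prod_type]
  refine (sum_le_sum fun j _ => hstep j).trans ?_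
  rw [sum_add_distrib, ← sum_mul, hcol, one_mul, ← mul_sum]
  have hKβ : (1 / (2 * F) + K) * β = (1 + β) / 2 * K := by
    have hne := hβ1.ne'
    simp only [K]
    field_simp
    ring
  have h1 := mul_le_mul_of_nonneg_left hGS (by positivity : 0 ≤ 1 / (2 * F) + K)
  rw [← mul_assoc, hKβ] at h1
  have h2 := mul_le_mul_of_nonneg_right (le_max_right ((1 + β) / 2) (1 - q))
    (bregman_nonneg hlam x z)
  have h3 := mul_le_mul_of_nonneg_right (le_max_left ((1 + β) / 2) (1 - q))
    (mul_nonneg hK (sqnorm_nonneg w))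
  rw [mul_add]
  linarith

/-- The RSEGS algorithm converges linearly in expectation to
the unique solution `x⋆` of `min ½‖x‖₂² + λ‖x‖₁ s.t. x ∈ argmin_z ‖b − Cz‖₂`:
there are `c ≥ 0` and `ρ ∈ (0,1)` with `E[‖x^{(k)} − x⋆‖₂²] ≤ c·ρ^k` for all `k`,
where `x^{(k)} = S_λ(z^{(k)})`, the `k`-th iterate is a function of the `k`
independent index choices `s : Fin k → Fin n × Fin m` (a pair `(j, i)` being
chosen with probability `(‖C_{:,j}‖₂²/‖C‖_F²)·(‖C_{i,:}‖₂²/‖C‖_F²)`). -/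
theorem rsegs_linear_convergence {m n : ℕ}
    (C : Matrix (Fin m) (Fin n) ℝ) (b : Fin m → ℝ) (lam : ℝ) (hlam : 0 < lam)
    (xstar : Fin n → ℝ)
    (hfeas : ∀ u, nrm (b - C.mulVec xstar) ≤ nrm (b - C.mulVec u))
    (hmin : ∀ x, (∀ u, nrm (b - C.mulVec x) ≤ nrm (b - C.mulVec u)) →
      (1 / 2) * sqnorm xstar + lam * ∑ t, |xstar t| ≤ (1 / 2) * sqnorm x + lam * ∑ t, |x t|)
    (y0 : Fin n → ℝ) (z0 : Fin n → ℝ) (hz0 : z0 ∈ Set.range Cᵀ.mulVec) :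
    ∃ c ρ : ℝ, 0 ≤ c ∧ 0 < ρ ∧ ρ < 1 ∧
      ∀ k : ℕ,
        ∑ s : Fin k → Fin n × Fin m,
            (∏ t, (sqnorm (Cᵀ (s t).1) / frobSq C) * (sqnorm (C (s t).2) / frobSq C)) *
              sqnorm (Sshrink lam (rsegsIter C b lam y0 z0 (List.ofFn s)).2 - xstar)
          ≤ c * ρ ^ k := by
  have hx := transpose_mulVec_residual_eq_zero C b xstar hfeas
  have huniq := sshrink_eq_of_mulVec_sub_eq_zero C hlam xstar fun u hu =>
    hmin u fun v => by rw [hu]; exact hfeas v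
  rcases (frobSq_nonneg C).eq_or_lt with h0 | hF
  · refine ⟨sqnorm (Sshrink lam z0 - xstar), 1 / 2, sqnorm_nonneg _, by norm_num, by norm_num,
      fun k => ?_⟩
    cases k with
    | zero => simp [rsegsIter]
    | succ k =>
      have := sqnorm_nonneg (Sshrink lam z0 - xstar)
      simp only [← h0, div_zero, mul_zero, prod_const, card_univ, Fintype.card_fin,
        zero_pow (Nat.succ_ne_zero k), zero_mul, sum_const_zero]
      positivity
  obtain ⟨K, ρ, hK, hρ0, hρ1, hstep⟩ :=
    exists_potential_contraction C hF b hlam xstar hx huniq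
  let V : (Fin n → ℝ) × (Fin n → ℝ) → ℝ := fun s =>
    bregman lam xstar s.2 + K * sqnorm (C *ᵥ (s.1 - xstar))
  let w : Fin n × Fin m → ℝ := fun c =>
    (sqnorm (Cᵀ c.1) / frobSq C) * (sqnorm (C c.2) / frobSq C)
  have hw : ∀ c, 0 ≤ w c := fun c =>
    mul_nonneg (div_nonneg (sqnorm_nonneg _) hF.le) (div_nonneg (sqnorm_nonneg _) hF.le)
  have hV : ∀ s, sqnorm (Sshrink lam s.2 - xstar) ≤ 2 * V s := fun s => by
    have h1 := half_sqnorm_le_bregman hlam xstar s.2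
    have h2 := mul_nonneg hK (sqnorm_nonneg (C *ᵥ (s.1 - xstar)))
    simp only [V]
    linarith
  refine ⟨2 * V (y0, z0), ρ, (sqnorm_nonneg _).trans (hV _), hρ0, hρ1, fun k => ?_⟩
  have hdecay := sum_prod_mul_le_pow w hw (rsegsStep C b lam) (rsegsIter C b lam y0 z0)
    (fun _ _ => rfl) (fun s => s.2 ∈ Set.range Cᵀ.mulVec)
    (rsegsIter_snd_mem_range C b lam y0 z0 hz0) V ρ hρ0.le hstep k
  calc _ ≤ ∑ s : Fin k → Fin n × Fin m, (∏ t, w (s t)) *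
        (2 * V (rsegsIter C b lam y0 z0 (List.ofFn s))) :=
        sum_le_sum fun s _ => mul_le_mul_of_nonneg_left (hV _) (prod_nonneg fun t _ => hw _)
    _ = 2 * ∑ s : Fin k → Fin n × Fin m, (∏ t, w (s t)) *
        V (rsegsIter C b lam y0 z0 (List.ofFn s)) := by
        rw [mul_sum]
        exact sum_congr rfl fun s _ => by ring
    _ ≤ _ := by
        rw [mul_assoc]
        exact mul_le_mul_of_nonneg_left hdecay zero_le_two

end
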